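/- arXiv:1605.00952 — 2 statements merged into one kernel-verified Lean document; each statement's English description precedes it below -/
import Mathlib

section
/- Let H be a real Hilbert space and let f, g : H → (−∞,+∞] be proper, convex and lower semicontinuous with dom g ⊂ dom f, and assume f is Gâteaux differentiable at every point of dom g with gradient ∇f. Let x ∈ dom g, γ > 0, λ ∈ (0,1], δ ∈ (0,1), let y ∈ H satisfy (x − y)/γ − ∇f(x) ∈ ∂g(y), and set x⁺ = x + λ(y − x). If (f+g)(x⁺) − (f+g)(x) ≤ (1 − δ)·λ·( g(y) − g(x) + ⟪y − x, ∇f(x)⟫ ), then for every z ∈ dom g: ‖x⁺ − z‖² ≤ ‖x − z‖² + 2γλ·( (f+g)(z) − (f+g)(x) ) + (2γ/(1−δ))·( (f+g)(x) − (f+g)(x⁺) ) − ‖x⁺ − x‖². -/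
open scoped RealInnerProductSpace
open Filter Topology

attribute [local instance] Classical.propDecidable

/-- The gradient inequality for a convex function along a segment, from the one-sided limit of
the difference quotients. -/
theorem ConvexOn.le_sub_of_tendsto_slope {E : Type*} [AddCommGroup E] [Module ℝ E]
    {s : Set E} {f : E → ℝ} (hf : ConvexOn ℝ s f) {x z : E} (hx : x ∈ s) (hz : z ∈ s) {a : ℝ}
    (ha : Tendsto (fun t : ℝ => (f (x + t • (z - x)) - f x) / t) (𝓝[>] 0) (𝓝 a)) :
    a ≤ f z - f x := by
  refine le_of_tendsto ha ?_
  filter_upwards [Ioc_mem_nhdsGT (zero_lt_one' ℝ)] with t ht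
  have h := hf.2 hx hz (sub_nonneg.2 ht.2) ht.1.le (sub_add_cancel 1 t)
  have e : (1 - t) • x + t • z = x + t • (z - x) := by module
  rw [e, smul_eq_mul, smul_eq_mul] at h
  rw [div_le_iff₀ ht.1]
  linarith

/-- For a relaxed forward–backward step `x⁺ = x + λ(y − x)` with
`y = prox_{γg}(x − γ∇f(x))` (encoded by `(x − y)/γ − ∇f(x) ∈ ∂g(y)`), the
Armijo-type sufficient decrease condition yields the quasi-Fejér inequality. -/
theorem stmt_12
    {H : Type*} [NormedAddCommGroup H] [InnerProductSpace ℝ H] [CompleteSpace H]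
    (domf domg : Set H) (f g : H → ℝ)
    (hdomf_ne : domf.Nonempty) (hdomf_cvx : Convex ℝ domf)
    (hf_cvx : ConvexOn ℝ domf f)
    (hf_lsc : LowerSemicontinuous fun z : H => if z ∈ domf then (f z : EReal) else ⊤)
    (hdomg_ne : domg.Nonempty) (hdomg_cvx : Convex ℝ domg)
    (hg_cvx : ConvexOn ℝ domg g)
    (hg_lsc : LowerSemicontinuous fun z : H => if z ∈ domg then (g z : EReal) else ⊤)
    (hdom : domg ⊆ domf)
    (f' : H → H)
    (hgat : ∀ z ∈ domg, ∀ d : H,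
      Tendsto (fun t : ℝ => (f (z + t • d) - f z) / t) (nhdsWithin 0 {(0 : ℝ)}ᶜ)
        (nhds ⟪d, f' z⟫))
    (x : H) (hx : x ∈ domg) (γ lam δ : ℝ)
    (hγ : 0 < γ) (hlam0 : 0 < lam) (hlam1 : lam ≤ 1) (hδ0 : 0 < δ) (hδ1 : δ < 1)
    (y : H) (hy : y ∈ domg)
    (hprox : ∀ w ∈ domg, g y + ⟪w - y, γ⁻¹ • (x - y) - f' x⟫ ≤ g w)
    (xp : H) (hxp : xp = x + lam • (y - x))
    (harmijo : (f + g) xp - (f + g) x ≤ (1 - δ) * lam * (g y - g x + ⟪y - x, f' x⟫)) :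
    ∀ z ∈ domg,
      ‖xp - z‖ ^ 2 ≤ ‖x - z‖ ^ 2
        + 2 * γ * lam * ((f + g) z - (f + g) x)
        + 2 * γ / (1 - δ) * ((f + g) x - (f + g) xp)
        - ‖xp - x‖ ^ 2 := by
  intro z hz
  have hgrad : ⟪z - x, f' x⟫ ≤ f z - f x :=
    hf_cvx.le_sub_of_tendsto_slope (hdom hx) (hdom hz)
      ((hgat x hx (z - x)).mono_left (nhdsWithin_mono 0 fun t ht => ne_of_gt ht))
  have hp := hprox z hz
  have hinner : γ * ⟪z - y, γ⁻¹ • (x - y) - f' x⟫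
      = ⟪y - x, x - z⟫ + ‖y - x‖ ^ 2 - γ * (⟪z - x, f' x⟫ - ⟪y - x, f' x⟫) := by
    rw [← real_inner_self_eq_norm_sq, inner_sub_right, inner_smul_right, mul_sub,
      mul_inv_cancel_left₀ hγ.ne', ← inner_sub_left, sub_sub_sub_cancel_right]
    simp only [inner_sub_left, inner_sub_right, real_inner_comm x y, real_inner_comm z y,
      real_inner_comm z x]
    ring
  have hstep : ⟪y - x, x - z⟫ + ‖y - x‖ ^ 2
      ≤ γ * ((f + g) z - (f + g) x - (g y - g x + ⟪y - x, f' x⟫)) := by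
    have h₁ := mul_le_mul_of_nonneg_left hp hγ.le
    have h₂ := mul_le_mul_of_nonneg_left hgrad hγ.le
    rw [mul_add, hinner] at h₁
    simp only [Pi.add_apply]
    linarith
  have hdecr : -(lam * (g y - g x + ⟪y - x, f' x⟫)) ≤ ((f + g) x - (f + g) xp) / (1 - δ) := by
    rw [le_div_iff₀ (sub_pos.2 hδ1)]
    linarith
  have hnorm : ‖xp - z‖ ^ 2
      = ‖x - z‖ ^ 2 + 2 * lam * ⟪y - x, x - z⟫ + lam ^ 2 * ‖y - x‖ ^ 2 := by
    have e : xp - z = (x - z) + lam • (y - x) := by rw [hxp]; abel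
    rw [e, norm_add_sq_real, inner_smul_right, norm_smul, mul_pow, Real.norm_eq_abs, sq_abs,
      real_inner_comm]
    ring
  have hmove : ‖xp - x‖ ^ 2 = lam ^ 2 * ‖y - x‖ ^ 2 := by
    rw [hxp, add_sub_cancel_left, norm_smul, mul_pow, Real.norm_eq_abs, sq_abs]
  have hlam : lam ^ 2 * ‖y - x‖ ^ 2 ≤ lam * ‖y - x‖ ^ 2 :=
    mul_le_mul_of_nonneg_right (pow_le_of_le_one hlam0.le hlam1 two_ne_zero) (sq_nonneg _)
  have h₁ := mul_le_mul_of_nonneg_left hstep hlam0.le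
  have h₂ := mul_le_mul_of_nonneg_left hdecr hγ.le
  have e : 2 * γ / (1 - δ) * ((f + g) x - (f + g) xp)
      = 2 * (γ * (((f + g) x - (f + g) xp) / (1 - δ))) := by ring
  rw [hnorm, hmove, e]
  linarith
end

section
/- Let H be a real Hilbert space and let f, g : H → (−∞,+∞] be proper, convex and lower semicontinuous with dom g ⊂ dom f. Assume f is Gâteaux differentiable at every point of dom g with gradient ∇f, and ∇f is L-Lipschitz continuous on dom g for some L > 0. Let (W_k)_{k∈ℕ} be bounded self-adjoint operators on H and 0 < ν ≤ μ with ν‖x‖² ≤ ⟪x, W_k x⟫ ≤ μ‖x‖² for all k and x, and suppose there is a nonnegative summable sequence (η_k) with ⟪x, W_{k+1} x⟫ ≤ (1 + η_k)·⟪x, W_k x⟫ for all k and x. For each k let ν_k = inf_{‖x‖=1} ⟪x, W_k x⟫. Let (γ_k) in (0,∞) and (λ_k) in (0,1] satisfy inf_k γ_k > 0, inf_k λ_k > 0 and sup_k γ_k λ_k / ν_k < 2/L. Let x_0 ∈ dom g and for each k let y_k ∈ dom g satisfy W_k((x_k − y_k)/γ_k) − ∇f(x_k) ∈ ∂g(y_k)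 (the variable-metric forward-backward step) and x_{k+1} = x_k + λ_k(y_k − x_k). If argmin_H(f+g) ≠ ∅, then: (x_k) and (y_k) converge weakly to one and the same minimizer of f+g; (f+g)(y_k) → inf_H(f+g); and k·( (f+g)(x_k) − inf_H(f+g) ) → 0. -/
open scoped RealInnerProductSpace
open Filter Topology

attribute [local instance] Classical.propDecidable
/-- A convex function lies above its tangent at a point of Gâteaux differentiability. -/
lemma ConvexOn.add_inner_gateaux_le {H : Type*} [NormedAddCommGroup H] [InnerProductSpace ℝ H]
    {D : Set H} {f : H → ℝ} (hf : ConvexOn ℝ D f) {z w v : H} (hz : z ∈ D) (hw : w ∈ D)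
    (hg : Tendsto (fun t : ℝ => (f (z + t • (w - z)) - f z) / t) (𝓝[≠] 0) (𝓝 ⟪w - z, v⟫)) :
    f z + ⟪w - z, v⟫ ≤ f w := by
  have hg' := hg.mono_left (nhdsWithin_mono (0 : ℝ) (s := Set.Ioi 0) fun t ht => ne_of_gt ht)
  have hle : ⟪w - z, v⟫ ≤ f w - f z := by
    refine le_of_tendsto hg' ?_
    filter_upwards [Ioo_mem_nhdsGT (zero_lt_one (α := ℝ))] with t ht
    rw [div_le_iff₀ ht.1]
    have hcomb := hf.2 hz hw (sub_nonneg.2 ht.2.le) ht.1.le (sub_add_cancel 1 t)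
    have harg : (1 - t) • z + t • w = z + t • (w - z) := by module
    rw [harg] at hcomb
    simp only [smul_eq_mul] at hcomb
    linarith
  linarith

/-- The descent lemma on a convex set where the Gâteaux gradient is Lipschitz continuous. -/
lemma le_add_inner_gateaux_add_sq {H : Type*} [NormedAddCommGroup H] [InnerProductSpace ℝ H]
    {D : Set H} (hD : Convex ℝ D) {f : H → ℝ} {f' : H → H}
    (hgat : ∀ z ∈ D, ∀ d : H,
      Tendsto (fun t : ℝ => (f (z + t • d) - f z) / t) (𝓝[≠] 0) (𝓝 ⟪d, f' z⟫))
    {L : ℝ} (hlip : ∀ a ∈ D, ∀ b ∈ D, ‖f' a - f' b‖ ≤ L * ‖a - b‖)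
    {a b : H} (ha : a ∈ D) (hb : b ∈ D) :
    f b ≤ f a + ⟪b - a, f' a⟫ + L / 2 * ‖b - a‖ ^ 2 := by
  set d := b - a with hd
  have hmem : ∀ t ∈ Set.Icc (0 : ℝ) 1, a + t • d ∈ D := fun t ht =>
    hD.add_smul_sub_mem ha hb ht
  let φ : ℝ → ℝ := fun t => f (a + t • d) - t * ⟪d, f' a⟫ - L / 2 * ‖d‖ ^ 2 * t ^ 2
  have hderiv : ∀ t ∈ Set.Icc (0 : ℝ) 1,
      HasDerivAt φ (⟪d, f' (a + t • d)⟫ - ⟪d, f' a⟫ - L * ‖d‖ ^ 2 * t) t := by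
    intro t ht
    have h₁ : HasDerivAt (fun s : ℝ => f (a + s • d)) ⟪d, f' (a + t • d)⟫ t := by
      rw [hasDerivAt_iff_tendsto_slope_zero]
      refine (hgat _ (hmem t ht) d).congr fun s => ?_
      rw [add_smul, add_assoc, smul_eq_mul, div_eq_inv_mul]
    have h₂ := (hasDerivAt_id t).mul_const ⟪d, f' a⟫
    have h₃ := ((hasDerivAt_id t).pow 2).const_mul (L / 2 * ‖d‖ ^ 2)
    convert! (h₁.sub h₂).sub h₃ using 1
    simp
    ring
  have hanti : AntitoneOn φ (Set.Icc 0 1) := by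
    refine antitoneOn_of_deriv_nonpos (convex_Icc 0 1)
      (fun t ht => (hderiv t ht).continuousAt.continuousWithinAt)
      (fun t ht => (hderiv t (interior_subset ht)).differentiableAt.differentiableWithinAt)
      fun t ht => ?_
    have ht' := interior_subset ht
    rw [(hderiv t ht').deriv, ← inner_sub_right]
    have h₁ := real_inner_le_norm d (f' (a + t • d) - f' a)
    have h₂ := hlip _ (hmem t ht') _ ha
    rw [add_sub_cancel_left, norm_smul, Real.norm_of_nonneg ht'.1] at h₂
    nlinarith [mul_le_mul_of_nonneg_left h₂ (norm_nonneg d)]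
  have h01 := hanti (Set.left_mem_Icc.2 zero_le_one) (Set.right_mem_Icc.2 zero_le_one) zero_le_one
  simp only [φ, one_smul, zero_smul, add_zero, hd, add_sub_cancel] at h01
  linarith

lemma exists_tendsto_prod_one_add {η : ℕ → ℝ} (hη : ∀ k, 0 ≤ η k) (hs : Summable η) :
    ∃ p : ℝ, Tendsto (fun k => ∏ i ∈ Finset.range k, (1 + η i)) atTop (𝓝 p) ∧
      ∀ k, 1 ≤ ∏ i ∈ Finset.range k, (1 + η i) ∧ ∏ i ∈ Finset.range k, (1 + η i) ≤ p := by
  have hlim := (Real.multipliable_one_add_of_summable hs).hasProd.tendsto_prod_nat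
  have hone : ∀ k, 1 ≤ ∏ i ∈ Finset.range k, (1 + η i) := fun k => by
    induction k with
    | zero => simp
    | succ k ih =>
      rw [Finset.prod_range_succ]
      nlinarith [hη k]
  have hmono : Monotone fun k => ∏ i ∈ Finset.range k, (1 + η i) := by
    refine monotone_nat_of_le_succ fun k => ?_
    rw [Finset.prod_range_succ]
    nlinarith [hη k, hone k]
  exact ⟨_, hlim, fun k => ⟨hone k, hmono.ge_of_tendsto hlim k⟩⟩

/-- The Robbins–Siegmund lemma for real sequences. -/
lemma exists_tendsto_and_summable_of_le_one_add_mul {a b ε η : ℕ → ℝ} (ha : ∀ k, 0 ≤ a k)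
    (hb : ∀ k, 0 ≤ b k) (hε : ∀ k, 0 ≤ ε k) (hη : ∀ k, 0 ≤ η k) (hsε : Summable ε)
    (hsη : Summable η) (h : ∀ k, a (k + 1) ≤ (1 + η k) * (a k - b k + ε k)) :
    (∃ l, Tendsto a atTop (𝓝 l)) ∧ Summable b := by
  obtain ⟨p, hp, hP⟩ := exists_tendsto_prod_one_add hη hsη
  set P : ℕ → ℝ := fun k => ∏ i ∈ Finset.range k, (1 + η i) with hPdef
  have hP1 : ∀ k, 1 ≤ P k := fun k => (hP k).1
  have hPp : ∀ k, P k ≤ p := fun k => (hP k).2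
  have hP0 : ∀ k, 0 < P k := fun k => zero_lt_one.trans_le (hP1 k)
  have hp0 : 0 < p := (hP0 0).trans_le (hPp 0)
  have hstep : ∀ k, a (k + 1) / P (k + 1) ≤ a k / P k - b k / p + ε k := by
    intro k
    have hη1 : 0 < 1 + η k := by linarith [hη k]
    have h₁ : a (k + 1) / P (k + 1) ≤ (a k - b k + ε k) / P k := by
      have hsucc : P (k + 1) = P k * (1 + η k) := Finset.prod_range_succ _ _
      rw [hsucc, div_le_div_iff₀ (mul_pos (hP0 k) hη1) (hP0 k)]
      nlinarith [mul_le_mul_of_nonneg_right (h k) (hP0 k).le]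
    have h₂ : b k / p ≤ b k / P k := div_le_div_of_nonneg_left (hb k) (hP0 k) (hPp k)
    have h₃ : ε k / P k ≤ ε k := div_le_self (hε k) (hP1 k)
    rw [add_div, sub_div] at h₁
    linarith
  have hεle : ∀ k, ∑ i ∈ Finset.range k, ε i ≤ ∑' i, ε i := fun k =>
    hsε.sum_le_tsum _ fun i _ => hε i
  let v : ℕ → ℝ := fun k =>
    a k / P k + ∑ i ∈ Finset.range k, b i / p - ∑ i ∈ Finset.range k, ε i
  have hv_eq : ∀ k, v k =
      a k / P k + ∑ i ∈ Finset.range k, b i / p - ∑ i ∈ Finset.range k, ε i := fun _ => rfl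
  have hv : Antitone v := antitone_nat_of_succ_le fun k => by
    simp only [v, Finset.sum_range_succ]
    linarith [hstep k]
  have hbp : ∀ k, 0 ≤ b k / p := fun k => div_nonneg (hb k) hp0.le
  have haP : ∀ k, 0 ≤ a k / P k := fun k => div_nonneg (ha k) (hP0 k).le
  have hsb : Summable fun k => b k / p := by
    refine summable_of_sum_range_le (c := v 0 + ∑' i, ε i) hbp fun k => ?_
    have h₁ := hv (Nat.zero_le k)
    linarith [haP k, hεle k, hv_eq k]
  refine ⟨?_, (hsb.mul_right p).congr fun k => div_mul_cancel₀ _ hp0.ne'⟩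
  have hbdd : BddBelow (Set.range v) := by
    refine ⟨-∑' i, ε i, ?_⟩
    rintro _ ⟨k, rfl⟩
    linarith [haP k, hεle k, hv_eq k,
      Finset.sum_nonneg fun i (_ : i ∈ Finset.range k) => hbp i]
  have hlim := (((tendsto_atTop_ciInf hv hbdd).sub hsb.hasSum.tendsto_sum_nat).add
    hsε.hasSum.tendsto_sum_nat).mul hp
  refine ⟨_, hlim.congr fun k => ?_⟩
  rw [hv_eq]
  change _ * P k = a k
  field_simp [(hP0 k).ne']
  ring

/-- The general term of a summable antitone sequence is `o(1 / k)`. -/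
lemma Antitone.tendsto_natCast_mul_of_summable {a : ℕ → ℝ} (ha : Antitone a) (hs : Summable a) :
    Tendsto (fun k : ℕ => (k : ℝ) * a k) atTop (𝓝 0) := by
  have h0 : ∀ k, 0 ≤ a k := fun k => ha.le_of_tendsto hs.tendsto_atTop_zero k
  have hS := hs.hasSum.tendsto_sum_nat
  have hhalf : Tendsto (fun k : ℕ => k / 2) atTop atTop :=
    Nat.tendsto_div_const_atTop two_ne_zero
  have hlim := (hS.sub (hS.comp hhalf)).const_mul 2
  rw [sub_self, mul_zero] at hlim
  refine squeeze_zero (fun k => mul_nonneg k.cast_nonneg (h0 k)) (fun k => ?_) hlim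
  have hle : k / 2 ≤ k := Nat.div_le_self k 2
  rw [Function.comp_apply, ← Finset.sum_Ico_eq_sub _ hle]
  have hcard := Finset.card_nsmul_le_sum (Finset.Ico (k / 2) k) a (a k) fun i hi =>
    ha (Finset.mem_Ico.1 hi).2.le
  rw [Nat.card_Ico, nsmul_eq_mul] at hcard
  have hk : (k : ℝ) ≤ 2 * ((k - k / 2 : ℕ) : ℝ) := by
    exact_mod_cast (by omega : k ≤ 2 * (k - k / 2))
  nlinarith [mul_le_mul_of_nonneg_right hk (h0 k)]

lemma norm_sq_apply_le_of_inner_le {H : Type*} [NormedAddCommGroup H] [InnerProductSpace ℝ H]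
    {T : H →L[ℝ] H} (hT : ∀ a b, ⟪T a, b⟫ = ⟪a, T b⟫) {C : ℝ} (hC : 0 < C)
    (h0 : ∀ a, 0 ≤ ⟪a, T a⟫) (h1 : ∀ a, ⟪a, T a⟫ ≤ C * ‖a‖ ^ 2) (u : H) :
    ‖T u‖ ^ 2 ≤ C * ⟪u, T u⟫ := by
  have h := h0 (C • u - T u)
  have h' := h1 (T u)
  have e1 : ⟪T u, T u⟫ = ‖T u‖ ^ 2 := real_inner_self_eq_norm_sq _
  have e2 : ⟪u, T (T u)⟫ = ‖T u‖ ^ 2 := by rw [← hT, e1]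
  simp only [map_sub, map_smul, inner_sub_left, inner_sub_right, real_inner_smul_left,
    real_inner_smul_right, e1, e2] at h
  nlinarith

/-- Positive self-adjoint operators that are decreasing up to summable relative errors converge
pointwise. -/
lemma exists_tendsto_apply_of_le_one_add_mul {H : Type*} [NormedAddCommGroup H]
    [InnerProductSpace ℝ H] [CompleteSpace H] {W : ℕ → H →L[ℝ] H}
    (hsa : ∀ k : ℕ, ∀ a b : H, ⟪W k a, b⟫ = ⟪a, W k b⟫) {μ : ℝ} (hμ : 0 < μ)
    (hW0 : ∀ k : ℕ, ∀ a : H, 0 ≤ ⟪a, W k a⟫) (hWμ : ∀ k : ℕ, ∀ a : H, ⟪a, W k a⟫ ≤ μ * ‖a‖ ^ 2)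
    {η : ℕ → ℝ} (hη : ∀ k, 0 ≤ η k) (hs : Summable η)
    (hWη : ∀ k : ℕ, ∀ a : H, ⟪a, W (k + 1) a⟫ ≤ (1 + η k) * ⟪a, W k a⟫) (u : H) :
    ∃ w, Tendsto (fun k => W k u) atTop (𝓝 w) := by
  obtain ⟨p, hp, hP⟩ := exists_tendsto_prod_one_add hη hs
  set P : ℕ → ℝ := fun k => ∏ i ∈ Finset.range k, (1 + η i) with hPdef
  have hP1 : ∀ k, 1 ≤ P k := fun k => (hP k).1
  have hP0 : ∀ k, 0 < P k := fun k => zero_lt_one.trans_le (hP1 k)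
  let A : ℕ → H →L[ℝ] H := fun k => (P k)⁻¹ • W k
  have hAinner : ∀ k a, ⟪a, A k a⟫ = (P k)⁻¹ * ⟪a, W k a⟫ := fun k a =>
    real_inner_smul_right _ _ _
  have hA0 : ∀ k a, 0 ≤ ⟪a, A k a⟫ := fun k a => by
    rw [hAinner]
    exact mul_nonneg (inv_nonneg.2 (hP0 k).le) (hW0 k a)
  have hAμ : ∀ k a, ⟪a, A k a⟫ ≤ μ * ‖a‖ ^ 2 := fun k a => by
    rw [hAinner]
    exact (mul_le_of_le_one_left (hW0 k a) (inv_le_one_of_one_le₀ (hP1 k))).trans (hWμ k a)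
  have hAanti : ∀ a, Antitone fun k => ⟪a, A k a⟫ := fun a =>
    antitone_nat_of_succ_le fun k => by
      have hη1 : 0 < 1 + η k := by linarith [hη k]
      have hsucc : P (k + 1) = P k * (1 + η k) := Finset.prod_range_succ _ _
      rw [hAinner, hAinner, hsucc, mul_inv, mul_assoc]
      gcongr
      · exact inv_nonneg.2 (hP0 k).le
      · rw [inv_mul_le_iff₀ hη1]
        exact hWη k a
  have hlim := tendsto_atTop_ciInf (hAanti u) ⟨0, by rintro _ ⟨k, rfl⟩; exact hA0 k u⟩
  set l := ⨅ k, ⟪u, A k u⟫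
  have hcauchy : CauchySeq fun k => A k u := by
    refine cauchySeq_of_le_tendsto_0' (fun n => √(μ * (⟪u, A n u⟫ - l))) (fun n m hnm => ?_) ?_
    · rw [dist_eq_norm]
      refine Real.le_sqrt_of_sq_le ?_
      have hdiff : ∀ a, ⟪a, (A n - A m) a⟫ = ⟪a, A n a⟫ - ⟪a, A m a⟫ := fun a =>
        inner_sub_right _ _ _
      have hsq := norm_sq_apply_le_of_inner_le (T := A n - A m)
        (fun a b => by
          simp [A, inner_sub_left, inner_sub_right, real_inner_smul_left, real_inner_smul_right,
            hsa])
        hμ (fun a => by rw [hdiff]; exact sub_nonneg.2 (hAanti a hnm))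
        (fun a => by rw [hdiff]; linarith [hA0 m a, hAμ n a]) u
      rw [hdiff] at hsq
      refine hsq.trans (mul_le_mul_of_nonneg_left ?_ hμ.le)
      linarith [(hAanti u).le_of_tendsto hlim m]
    · have h := (((hlim.sub_const l).const_mul μ).sqrt)
      simpa using h
  obtain ⟨w, hw⟩ := cauchySeq_tendsto_of_complete hcauchy
  refine ⟨p • w, (hp.smul hw).congr fun k => ?_⟩
  change P k • (P k)⁻¹ • W k u = W k u
  rw [smul_inv_smul₀ (hP0 k).ne']

/-- A bounded sequence in a Hilbert space converges weakly along every ultrafilter. -/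
lemma Ultrafilter.exists_tendsto_inner_of_norm_le {H : Type*} [NormedAddCommGroup H]
    [InnerProductSpace ℝ H] [CompleteSpace H] {x : ℕ → H} {R : ℝ} (hx : ∀ k, ‖x k‖ ≤ R)
    (U : Ultrafilter ℕ) : ∃ z : H, ∀ u : H, Tendsto (fun k => ⟪x k, u⟫) U (𝓝 ⟪z, u⟫) := by
  let X : ℕ → WeakDual ℝ H := fun k =>
    StrongDual.toWeakDual (InnerProductSpace.toDual ℝ H (x k))
  obtain ⟨φ, -, hφ⟩ := (WeakDual.isCompact_closedBall (𝕜 := ℝ) (E := H) 0 R).ultrafilter_le_nhds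
    (U.map X) (by
      rw [le_principal_iff]
      refine Filter.mem_map.2 (Filter.univ_mem' fun k => ?_)
      simpa [X] using hx k)
  refine ⟨(InnerProductSpace.toDual ℝ H).symm (WeakDual.toStrongDual φ), fun u => ?_⟩
  rw [InnerProductSpace.toDual_symm_apply]
  exact ((WeakDual.eval_continuous u).tendsto φ).comp hφ

/-- Closed convex sets are weakly sequentially closed. -/
lemma Convex.mem_of_tendsto_inner {H : Type*} [NormedAddCommGroup H]
    [InnerProductSpace ℝ H] [CompleteSpace H] {S : Set H} (hS : Convex ℝ S) (hc : IsClosed S)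
    {ι : Type*} {l : Filter ι} [l.NeBot] {x : ι → H} {z : H}
    (hx : ∀ u : H, Tendsto (fun k => ⟪x k, u⟫) l (𝓝 ⟪z, u⟫)) (hmem : ∀ᶠ k in l, x k ∈ S) :
    z ∈ S := by
  by_contra hz
  obtain ⟨φ, c, hφ, hcz⟩ := geometric_hahn_banach_closed_point hS hc hz
  have hrep : ∀ a, ⟪a, (InnerProductSpace.toDual ℝ H).symm φ⟫ = φ a := fun a => by
    rw [real_inner_comm, InnerProductSpace.toDual_symm_apply]
  have hlim := hx ((InnerProductSpace.toDual ℝ H).symm φ)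
  simp only [hrep] at hlim
  exact absurd (le_of_tendsto hlim (hmem.mono fun k hk => (hφ _ hk).le)) (not_le.2 hcz)

/-- Opial's lemma for a variable metric: if the distances to the points of `C` converge in the
metrics `W k` and all weak cluster points lie in `C`, the sequence converges weakly. -/
lemma exists_tendsto_inner_of_variable_metric {H : Type*} [NormedAddCommGroup H]
    [InnerProductSpace ℝ H] [CompleteSpace H] {W : ℕ → H →L[ℝ] H}
    (hsa : ∀ k : ℕ, ∀ a b : H, ⟪W k a, b⟫ = ⟪a, W k b⟫) {ν : ℝ} (hν : 0 < ν)
    (hWν : ∀ k : ℕ, ∀ a : H, ν * ‖a‖ ^ 2 ≤ ⟪a, W k a⟫)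
    (hWlim : ∀ u, ∃ w, Tendsto (fun k => W k u) atTop (𝓝 w))
    {C : Set H} {x : ℕ → H} {R : ℝ} (hx : ∀ k, ‖x k‖ ≤ R)
    (hdist : ∀ z ∈ C, ∃ l, Tendsto (fun k => ⟪x k - z, W k (x k - z)⟫) atTop (𝓝 l))
    (hcluster : ∀ U : Ultrafilter ℕ, (U : Filter ℕ) ≤ atTop → ∀ z : H,
      (∀ u : H, Tendsto (fun k => ⟪x k, u⟫) U (𝓝 ⟪z, u⟫)) → z ∈ C) :
    ∃ z ∈ C, ∀ u : H, Tendsto (fun k => ⟪x k, u⟫) atTop (𝓝 ⟪z, u⟫) := by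
  have huniq : ∀ U V : Ultrafilter ℕ, (U : Filter ℕ) ≤ atTop → (V : Filter ℕ) ≤ atTop →
      ∀ z z' : H, (∀ u : H, Tendsto (fun k => ⟪x k, u⟫) U (𝓝 ⟪z, u⟫)) →
      (∀ u : H, Tendsto (fun k => ⟪x k, u⟫) V (𝓝 ⟪z', u⟫)) → z = z' := by
    intro U V hU hV z z' hz hz'
    obtain ⟨l, hl⟩ := hdist z (hcluster U hU z hz)
    obtain ⟨l', hl'⟩ := hdist z' (hcluster V hV z' hz')
    obtain ⟨w, hw⟩ := hWlim (z - z')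
    obtain ⟨s, hs⟩ := hWlim z
    obtain ⟨s', hs'⟩ := hWlim z'
    have hWk : Tendsto (fun k => ⟪x k, W k (z - z')⟫) atTop
        (𝓝 ((l' - l + ⟪z, s⟫ - ⟪z', s'⟫) / 2)) := by
      refine ((((hl'.sub hl).add (tendsto_const_nhds.inner hs)).sub
        (tendsto_const_nhds.inner hs')).div_const 2).congr fun k => ?_
      have e : ⟪z, W k (x k)⟫ = ⟪x k, W k z⟫ := by rw [← hsa, real_inner_comm]
      have e' : ⟪z', W k (x k)⟫ = ⟪x k, W k z'⟫ := by rw [← hsa, real_inner_comm]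
      simp only [map_sub, inner_sub_left, inner_sub_right, e, e']
      ring
    have herr : Tendsto (fun k => ⟪x k, W k (z - z') - w⟫) atTop (𝓝 0) := by
      have h0 : Tendsto (fun k => R * ‖W k (z - z') - w‖) atTop (𝓝 0) := by
        simpa using (tendsto_iff_norm_sub_tendsto_zero.1 hw).const_mul R
      refine squeeze_zero_norm (fun k => ?_) h0
      exact (norm_inner_le_norm _ _).trans (mul_le_mul_of_nonneg_right (hx k) (norm_nonneg _))
    have hxw := (hWk.sub herr).congr fun k => by rw [← inner_sub_right, sub_sub_cancel]
    have e₁ := tendsto_nhds_unique (hz w) (hxw.mono_left hU)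
    have e₂ := tendsto_nhds_unique (hz' w) (hxw.mono_left hV)
    have hzero : ⟪z - z', w⟫ = 0 := by rw [inner_sub_left, e₁, e₂, sub_self]
    have hle : ν * ‖z - z'‖ ^ 2 ≤ ⟪z - z', w⟫ :=
      ge_of_tendsto' (tendsto_const_nhds.inner hw) fun k => hWν k _
    have hsq : ‖z - z'‖ ^ 2 ≤ 0 := nonpos_of_mul_nonpos_right (hle.trans_eq hzero) hν
    exact sub_eq_zero.1 (norm_eq_zero.1 (pow_eq_zero_iff two_ne_zero |>.1
      (le_antisymm hsq (sq_nonneg _))))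
  have hU₀ : (Ultrafilter.of (atTop : Filter ℕ) : Filter ℕ) ≤ atTop := Ultrafilter.of_le _
  obtain ⟨z, hz⟩ := (Ultrafilter.of (atTop : Filter ℕ)).exists_tendsto_inner_of_norm_le hx
  refine ⟨z, hcluster _ hU₀ z hz, fun u => (tendsto_iff_ultrafilter _ _ _).2 fun V hV => ?_⟩
  obtain ⟨z', hz'⟩ := V.exists_tendsto_inner_of_norm_le hx
  rw [huniq _ V hU₀ hV z z' hz hz']
  exact hz' u

/-- Sublevel sets of the sum of two lower semicontinuous functions extended by `⊤` are closed. -/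
lemma isClosed_sublevel_add {H : Type*} [TopologicalSpace H] {A B : Set H} {f g : H → ℝ}
    (hf : LowerSemicontinuous fun z : H => if z ∈ A then (f z : EReal) else ⊤)
    (hg : LowerSemicontinuous fun z : H => if z ∈ B then (g z : EReal) else ⊤)
    (hBA : B ⊆ A) (c : ℝ) : IsClosed {z ∈ B | f z + g z ≤ c} := by
  have hfb : ∀ z, (if z ∈ A then (f z : EReal) else ⊤) ≠ ⊥ := fun z => by split_ifs <;> simp
  have hgb : ∀ z, (if z ∈ B then (g z : EReal) else ⊤) ≠ ⊥ := fun z => by split_ifs <;> simp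
  have h := (hf.add' hg fun z => EReal.continuousAt_add (.inr (hgb z))
    (.inl (hfb z))).isClosed_preimage (c : EReal)
  convert h using 1
  ext z
  by_cases hB : z ∈ B
  · simp only [Set.mem_ofPred_eq, hB, true_and, Set.mem_preimage, hBA hB, if_true, Set.mem_Iic]
    exact_mod_cast Iff.rfl
  · by_cases hA : z ∈ A <;> simp [hA, hB]

/-- One relaxed forward-backward step in the metric `T`: the step length is controlled by the
decrease of the linearized objective, the objective decreases up to a quadratic term, and the
distance to any point of the domain satisfies a Fejér-type inequality. -/
lemma forward_backward_step {H : Type*} [NormedAddCommGroup H] [InnerProductSpace ℝ H]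
    {D : Set H} {f g : H → ℝ} {f' : H → H} (hf : ConvexOn ℝ D f) (hg : ConvexOn ℝ D g)
    (hgat : ∀ z ∈ D, ∀ d : H,
      Tendsto (fun t : ℝ => (f (z + t • d) - f z) / t) (𝓝[≠] 0) (𝓝 ⟪d, f' z⟫))
    {L : ℝ} (hlip : ∀ a ∈ D, ∀ b ∈ D, ‖f' a - f' b‖ ≤ L * ‖a - b‖)
    {T : H →L[ℝ] H} (hT : ∀ a b, ⟪T a, b⟫ = ⟪a, T b⟫) (hT0 : ∀ a, 0 ≤ ⟪a, T a⟫)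
    {γ t : ℝ} (hγ : 0 < γ) (ht0 : 0 < t) (ht1 : t ≤ 1) {x y : H} (hx : x ∈ D) (hyD : y ∈ D)
    (hy : ∀ w ∈ D, g y + ⟪w - y, T (γ⁻¹ • (x - y)) - f' x⟫ ≤ g w) :
    ⟪y - x, T (y - x)⟫ ≤ γ * (g x - g y - ⟪y - x, f' x⟫) ∧
    f (x + t • (y - x)) + g (x + t • (y - x)) ≤
      f x + g x - t * (g x - g y - ⟪y - x, f' x⟫) + L / 2 * t ^ 2 * ‖y - x‖ ^ 2 ∧
    ∀ w ∈ D, ⟪x + t • (y - x) - w, T (x + t • (y - x) - w)⟫ ≤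
      ⟪x - w, T (x - w)⟫ - 2 * (t * γ) * (f x + g x - (f w + g w)) +
        2 * (t * γ) * (g x - g y - ⟪y - x, f' x⟫) := by
  have hprox : ∀ w ∈ D, γ * g y + ⟪w - y, T (x - y)⟫ - γ * ⟪w - y, f' x⟫ ≤ γ * g w := by
    intro w hw
    have h := mul_le_mul_of_nonneg_left (hy w hw) hγ.le
    rw [inner_sub_right, map_smul, real_inner_smul_right, mul_add, mul_sub,
      mul_inv_cancel_left₀ hγ.ne'] at h
    linarith
  refine ⟨?_, ?_, fun w hw => ?_⟩
  · have h := hprox x hx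
    have e : ⟪x - y, T (x - y)⟫ = ⟪y - x, T (y - x)⟫ := by
      rw [← neg_sub y x, map_neg, inner_neg_neg]
    have e' : ⟪x - y, f' x⟫ = -⟪y - x, f' x⟫ := by rw [← neg_sub y x, inner_neg_left]
    rw [e, e'] at h
    linarith
  · have hmem : x + t • (y - x) ∈ D := hf.1.add_smul_sub_mem hx hyD ⟨ht0.le, ht1⟩
    have hdesc := le_add_inner_gateaux_add_sq hf.1 hgat hlip hx hmem
    rw [add_sub_cancel_left, real_inner_smul_left, norm_smul, Real.norm_of_nonneg ht0.le] at hdesc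
    have hcomb := hg.2 hx hyD (sub_nonneg.2 ht1) ht0.le (sub_add_cancel 1 t)
    have harg : (1 - t) • x + t • y = x + t • (y - x) := by module
    rw [harg, smul_eq_mul, smul_eq_mul] at hcomb
    nlinarith
  · have htan := hf.add_inner_gateaux_le hx hw (hgat x hx (w - x))
    have h := hprox w hw
    have hd := hT0 (y - x)
    obtain ⟨d, rfl⟩ : ∃ d, y = x + d := ⟨y - x, (add_sub_cancel x y).symm⟩
    obtain ⟨e, rfl⟩ : ∃ e, w = x - e := ⟨x - w, (sub_sub_cancel x w).symm⟩
    have s₁ : x - e - (x + d) = -(e + d) := by abel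
    have s₂ : x - (x + d) = -d := by abel
    have s₃ : x + t • d - (x - e) = e + t • d := by abel
    have s₄ : x - e - x = -e := by abel
    have hsymm : ⟪d, T e⟫ = ⟪e, T d⟫ := by rw [← hT, real_inner_comm]
    rw [s₁, s₂, map_neg, inner_neg_neg, inner_neg_left, inner_add_left, inner_add_left] at h
    rw [s₄, inner_neg_left] at htan
    rw [add_sub_cancel_left] at hd
    rw [add_sub_cancel_left, s₃, sub_sub_cancel]
    simp only [map_add, map_smul, inner_add_left, inner_add_right, real_inner_smul_left,
      real_inner_smul_right, hsymm]
    have h₁ := mul_le_mul_of_nonneg_left htan (mul_nonneg ht0.le hγ.le)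
    have h₂ := mul_le_mul_of_nonneg_left h ht0.le
    have h₃ : t * t * ⟪d, T d⟫ ≤ t * ⟪d, T d⟫ :=
      mul_le_mul_of_nonneg_right (mul_le_of_le_one_left ht0.le ht1) hd
    have h₄ := mul_nonneg ht0.le hd
    nlinarith

/-- The infimum of a quadratic form over the unit sphere bounds it from below. -/
lemma sInf_sphere_mul_norm_sq_le {H : Type*} [NormedAddCommGroup H] [InnerProductSpace ℝ H]
    {T : H →L[ℝ] H} {ν : ℝ} (hν : ∀ a : H, ν * ‖a‖ ^ 2 ≤ ⟪a, T a⟫) (d : H) :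
    sInf ((fun a : H => ⟪a, T a⟫) '' {a : H | ‖a‖ = 1}) * ‖d‖ ^ 2 ≤ ⟪d, T d⟫ := by
  rcases eq_or_ne d 0 with rfl | hd
  · simp
  have hn : 0 < ‖d‖ := norm_pos_iff.2 hd
  have hbdd : BddBelow ((fun a : H => ⟪a, T a⟫) '' {a : H | ‖a‖ = 1}) := by
    refine ⟨ν, ?_⟩
    rintro _ ⟨a, ha, rfl⟩
    have ha' : ‖a‖ = 1 := ha
    simpa [ha'] using hν a
  have hle := csInf_le hbdd ⟨‖d‖⁻¹ • d, norm_smul_inv_norm (𝕜 := ℝ) hd, rfl⟩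
  simp only [map_smul, real_inner_smul_left, real_inner_smul_right] at hle
  calc _ ≤ ‖d‖⁻¹ * (‖d‖⁻¹ * ⟪d, T d⟫) * ‖d‖ ^ 2 := by gcongr
    _ = ⟪d, T d⟫ := by field_simp

/-- The variable metric forward–backward splitting algorithm
with a priori parameters, under the Lipschitz assumption on `∇f` on `dom g`
only.  Proper convex lsc functions `f, g` are modeled by pairs `(domf, f)`,
`(domg, g)`; the metrics are given by bounded self-adjoint operators `W_k` with
`ν‖·‖² ≤ ⟪·, W_k ·⟫ ≤ μ‖·‖²` and `⟪·, W_{k+1} ·⟫ ≤ (1+η_k)⟪·, W_k ·⟫` with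
`(η_k)` nonnegative summable.  `ν_k` is the minimum eigenvalue
`inf_{‖a‖=1} ⟪a, W_k a⟫`, and `sup_k γ_k λ_k / ν_k < 2/L` is expressed by a
bound `ρ < 2/L`.  The forward-backward step `y_k` is characterized by the
subgradient inclusion `W_k((x_k − y_k)/γ_k) − ∇f(x_k) ∈ ∂g(y_k)`, and
`x_{k+1} = x_k + λ_k(y_k − x_k)`.  If `argmin (f+g) ≠ ∅`, then `(x_k)` and
`(y_k)` converge weakly to one and the same minimizer of `f+g`,
`(f+g)(y_k) → inf (f+g)`, and `k·((f+g)(x_k) − inf (f+g)) → 0`. -/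
theorem stmt_18
    {H : Type*} [NormedAddCommGroup H] [InnerProductSpace ℝ H] [CompleteSpace H]
    (domf domg : Set H) (f g : H → ℝ)
    (hdomf_ne : domf.Nonempty) (hdomf_cvx : Convex ℝ domf)
    (hf_cvx : ConvexOn ℝ domf f)
    (hf_lsc : LowerSemicontinuous fun z : H => if z ∈ domf then (f z : EReal) else ⊤)
    (hdomg_ne : domg.Nonempty) (hdomg_cvx : Convex ℝ domg)
    (hg_cvx : ConvexOn ℝ domg g)
    (hg_lsc : LowerSemicontinuous fun z : H => if z ∈ domg then (g z : EReal) else ⊤)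
    (hdom : domg ⊆ domf)
    (f' : H → H)
    (hgat : ∀ z ∈ domg, ∀ d : H,
      Tendsto (fun t : ℝ => (f (z + t • d) - f z) / t) (nhdsWithin 0 {(0 : ℝ)}ᶜ)
        (nhds ⟪d, f' z⟫))
    (L : ℝ) (hL : 0 < L)
    (hlip : ∀ a ∈ domg, ∀ b ∈ domg, ‖f' a - f' b‖ ≤ L * ‖a - b‖)
    (W : ℕ → H →L[ℝ] H)
    (hsa : ∀ k : ℕ, ∀ a b : H, ⟪W k a, b⟫ = ⟪a, W k b⟫)
    (ν μ : ℝ) (hν : 0 < ν) (hνμ : ν ≤ μ)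
    (hWlow : ∀ k : ℕ, ∀ a : H, ν * ‖a‖ ^ 2 ≤ ⟪a, W k a⟫)
    (hWhigh : ∀ k : ℕ, ∀ a : H, ⟪a, W k a⟫ ≤ μ * ‖a‖ ^ 2)
    (η : ℕ → ℝ) (hη0 : ∀ k, 0 ≤ η k) (hηsum : Summable η)
    (hWmono : ∀ k : ℕ, ∀ a : H, ⟪a, W (k + 1) a⟫ ≤ (1 + η k) * ⟪a, W k a⟫)
    (γ lam : ℕ → ℝ)
    (hγpos : ∀ k, 0 < γ k) (hγinf : ∃ a > (0 : ℝ), ∀ k, a ≤ γ k)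
    (hlam0 : ∀ k, 0 < lam k) (hlam1 : ∀ k, lam k ≤ 1)
    (hlaminf : ∃ b > (0 : ℝ), ∀ k, b ≤ lam k)
    (hsup : ∃ ρ : ℝ, ρ < 2 / L ∧ ∀ k : ℕ,
      γ k * lam k / sInf ((fun a : H => ⟪a, W k a⟫) '' {a : H | ‖a‖ = 1}) ≤ ρ)
    (x y : ℕ → H)
    (hx0 : x 0 ∈ domg)
    (hy : ∀ k : ℕ, y k ∈ domg ∧
      ∀ w ∈ domg,
        g (y k) + ⟪w - y k, W k ((γ k)⁻¹ • (x k - y k)) - f' (x k)⟫ ≤ g w)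
    (hrec : ∀ k : ℕ, x (k + 1) = x k + lam k • (y k - x k))
    (hargmin : ∃ m ∈ domg, ∀ w ∈ domg, f m + g m ≤ f w + g w) :
    ∃ xbar : H, xbar ∈ domg ∧ (∀ w ∈ domg, f xbar + g xbar ≤ f w + g w)
      ∧ (∀ u : H, Tendsto (fun k => ⟪x k, u⟫) atTop (nhds ⟪xbar, u⟫))
      ∧ (∀ u : H, Tendsto (fun k => ⟪y k, u⟫) atTop (nhds ⟪xbar, u⟫))
      ∧ Tendsto (fun k => f (y k) + g (y k)) atTop (nhds (f xbar + g xbar))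
      ∧ Tendsto (fun k : ℕ => (k : ℝ) * (f (x k) + g (x k) - (f xbar + g xbar)))
          atTop (nhds 0) := by
  obtain ⟨m, hm, hmin⟩ := hargmin
  rcases subsingleton_or_nontrivial H with hsub | hnt
  · have hconst : ∀ z : H, z = m := fun z => Subsingleton.elim z m
    refine ⟨m, hm, hmin, fun u => ?_, fun u => ?_, ?_, ?_⟩ <;> simp [hconst (x _), hconst (y _)]
  obtain ⟨γ₀, hγ₀, hγ₀le⟩ := hγinf
  obtain ⟨lam₀, hlam₀, hlam₀le⟩ := hlaminf
  obtain ⟨ρ, hρL, hρ⟩ := hsup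
  have hμ : 0 < μ := hν.trans_le hνμ
  have hW0 : ∀ k a, 0 ≤ ⟪a, W k a⟫ := fun k a => (by positivity : 0 ≤ ν * ‖a‖ ^ 2).trans (hWlow k a)
  obtain ⟨e, he⟩ := exists_norm_eq H zero_le_one
  have hνk : ∀ k, ν ≤ sInf ((fun a : H => ⟪a, W k a⟫) '' {a : H | ‖a‖ = 1}) := fun k => by
    refine le_csInf ⟨_, e, he, rfl⟩ ?_
    rintro _ ⟨a, ha, rfl⟩
    have ha' : ‖a‖ = 1 := ha
    simpa [ha'] using hWlow k a
  have hγlam : ∀ k, γ k * lam k ≤ ρ * sInf ((fun a : H => ⟪a, W k a⟫) '' {a : H | ‖a‖ = 1}) :=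
    fun k => (div_le_iff₀ (hν.trans_le (hνk k))).1 (hρ k)
  have hρ0 : 0 ≤ ρ := (div_nonneg (mul_nonneg (hγpos 0).le (hlam0 0).le)
    (hν.le.trans (hνk 0))).trans (hρ 0)
  have hstep_norm : ∀ k d, γ k * lam k * ‖d‖ ^ 2 ≤ ρ * ⟪d, W k d⟫ := fun k d =>
    calc γ k * lam k * ‖d‖ ^ 2
        ≤ ρ * sInf ((fun a : H => ⟪a, W k a⟫) '' {a : H | ‖a‖ = 1}) * ‖d‖ ^ 2 := by
          exact mul_le_mul_of_nonneg_right (hγlam k) (sq_nonneg _)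
      _ ≤ ρ * ⟪d, W k d⟫ := by
          rw [mul_assoc]
          exact mul_le_mul_of_nonneg_left (sInf_sphere_mul_norm_sq_le (hWlow k) d) hρ0
  have hγlamM : ∀ k, γ k * lam k ≤ ρ * μ := fun k => by
    have h := (hstep_norm k e).trans (mul_le_mul_of_nonneg_left (hWhigh k e) hρ0)
    simpa [he] using h
  set M := ρ * μ with hM
  have hM0 : 0 ≤ M := mul_nonneg hρ0 hμ.le
  have hγM : ∀ k, γ k ≤ M / lam₀ := fun k => by
    rw [le_div_iff₀ hlam₀]
    exact (mul_le_mul_of_nonneg_left (hlam₀le k) (hγpos k).le).trans (hγlamM k)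
  set θ := 1 - L / 2 * ρ with hθ
  have hθ0 : 0 < θ := by
    rw [lt_div_iff₀ hL] at hρL
    linarith
  have hf_cvx' : ConvexOn ℝ domg f := hf_cvx.subset hdom hdomg_cvx
  have hxmem : ∀ k, x k ∈ domg := fun k => by
    induction k with
    | zero => exact hx0
    | succ k ih =>
      rw [hrec]
      exact hdomg_cvx.add_smul_sub_mem ih (hy k).1 ⟨(hlam0 k).le, hlam1 k⟩
  let δ : ℕ → ℝ := fun k => g (x k) - g (y k) - ⟪y k - x k, f' (x k)⟫
  let r : ℕ → ℝ := fun k => f (x k) + g (x k) - (f m + g m)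
  have hstep := fun k => forward_backward_step hf_cvx' hg_cvx hgat hlip (hsa k) (hW0 k) (hγpos k)
    (hlam0 k) (hlam1 k) (hxmem k) (hy k).1 (hy k).2
  have hlen : ∀ k, ⟪y k - x k, W k (y k - x k)⟫ ≤ γ k * δ k := fun k => (hstep k).1
  have hδ : ∀ k, 0 ≤ δ k := fun k =>
    nonneg_of_mul_nonneg_right ((hW0 k _).trans (hlen k)) (hγpos k)
  have hr : ∀ k, 0 ≤ r k := fun k => sub_nonneg.2 (hmin _ (hxmem k))
  have hdecr : ∀ k, r (k + 1) ≤ r k - lam₀ * θ * δ k := by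
    intro k
    have h := (hstep k).2.1
    rw [← hrec] at h
    have h₁ : γ k * (L / 2 * lam k ^ 2 * ‖y k - x k‖ ^ 2) ≤ γ k * (lam k * (L / 2 * ρ) * δ k) :=
      calc γ k * (L / 2 * lam k ^ 2 * ‖y k - x k‖ ^ 2)
          = L / 2 * lam k * (γ k * lam k * ‖y k - x k‖ ^ 2) := by ring
        _ ≤ L / 2 * lam k * (ρ * (γ k * δ k)) := by
          have hc : 0 ≤ L / 2 * lam k := mul_nonneg (half_pos hL).le (hlam0 k).le
          exact mul_le_mul_of_nonneg_left ((hstep_norm k _).trans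
            (mul_le_mul_of_nonneg_left (hlen k) hρ0)) hc
        _ = γ k * (lam k * (L / 2 * ρ) * δ k) := by ring
    have h₂ := le_of_mul_le_mul_left h₁ (hγpos k)
    have h₃ : lam₀ * (θ * δ k) ≤ lam k * (θ * δ k) :=
      mul_le_mul_of_nonneg_right (hlam₀le k) (mul_nonneg hθ0.le (hδ k))
    have h₄ : lam k * (θ * δ k) = lam k * δ k - lam k * (L / 2 * ρ) * δ k := by
      rw [hθ]
      ring
    simp only [r]
    change _ ≤ f (x k) + g (x k) - lam k * δ k + _ at h
    linarith
  have hlamθ : 0 < lam₀ * θ := mul_pos hlam₀ hθ0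
  have hsδ : Summable δ := by
    have h := (exists_tendsto_and_summable_of_le_one_add_mul (ε := fun _ => 0) (η := fun _ => 0)
      hr (fun k => mul_nonneg hlamθ.le (hδ k)) (fun _ => le_rfl) (fun _ => le_rfl) summable_zero
      summable_zero fun k => by simpa using hdecr k).2
    exact (summable_mul_left_iff hlamθ.ne').1 h
  have hfejer : ∀ z ∈ domg, (∀ w ∈ domg, f z + g z ≤ f w + g w) →
      (∃ l, Tendsto (fun k => ⟪x k - z, W k (x k - z)⟫) atTop (𝓝 l)) ∧ Summable r := by
    intro z hz hzmin
    have hzm : f z + g z = f m + g m := le_antisymm (hzmin m hm) (hmin z hz)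
    have hc : 0 < 2 * (lam₀ * γ₀) := by positivity
    have h := exists_tendsto_and_summable_of_le_one_add_mul
      (a := fun k => ⟪x k - z, W k (x k - z)⟫) (b := fun k => 2 * (lam₀ * γ₀) * r k)
      (ε := fun k => 2 * M * δ k) (η := η) (fun k => hW0 k _)
      (fun k => mul_nonneg hc.le (hr k))
      (fun k => mul_nonneg (mul_nonneg zero_le_two hM0) (hδ k)) hη0
      (hsδ.mul_left _) hηsum fun k => by
        refine (hWmono k _).trans (mul_le_mul_of_nonneg_left ?_ (by linarith [hη0 k]))
        have h := (hstep k).2.2 z hz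
        rw [← hrec, hzm] at h
        change _ ≤ _ - 2 * (lam k * γ k) * r k + 2 * (lam k * γ k) * δ k at h
        have h₁ : lam₀ * γ₀ * r k ≤ lam k * γ k * r k :=
          mul_le_mul_of_nonneg_right
            (mul_le_mul (hlam₀le k) (hγ₀le k) hγ₀.le (hlam0 k).le) (hr k)
        have h₂ : lam k * γ k * δ k ≤ M * δ k :=
          mul_le_mul_of_nonneg_right ((mul_comm _ _).trans_le (hγlamM k)) (hδ k)
        linarith
    exact ⟨h.1, (summable_mul_left_iff hc.ne').1 h.2⟩
  obtain ⟨⟨l, hl⟩, hsr⟩ := hfejer m hm hmin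
  have hr_lim : Tendsto r atTop (𝓝 0) := hsr.tendsto_atTop_zero
  have hr_anti : Antitone r := antitone_nat_of_succ_le fun k => by
    linarith [hdecr k, mul_nonneg hlamθ.le (hδ k)]
  obtain ⟨B, hB⟩ := hl.bddAbove_range
  have hxbdd : ∀ k, ‖x k‖ ≤ √(B / ν) + ‖m‖ := fun k => by
    have h : ‖x k - m‖ ≤ √(B / ν) := by
      refine Real.le_sqrt_of_sq_le ?_
      rw [le_div_iff₀ hν, mul_comm]
      exact (hWlow k _).trans (hB ⟨k, rfl⟩)
    linarith [norm_le_norm_sub_add (x k) m]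
  have hcluster : ∀ U : Ultrafilter ℕ, (U : Filter ℕ) ≤ atTop → ∀ z : H,
      (∀ u : H, Tendsto (fun k => ⟪x k, u⟫) U (𝓝 ⟪z, u⟫)) →
      z ∈ {z ∈ domg | ∀ w ∈ domg, f z + g z ≤ f w + g w} := by
    intro U hU z hz
    have hsublevel : ∀ ε > 0, z ∈ {z ∈ domg | f z + g z ≤ f m + g m + ε} := by
      intro ε hε
      refine Convex.mem_of_tendsto_inner ((hf_cvx'.add hg_cvx).convex_le _)
        (isClosed_sublevel_add hf_lsc hg_lsc hdom _) hz (hU ?_)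
      filter_upwards [hr_lim.eventually_le_const hε] with k hk
      refine ⟨hxmem k, ?_⟩
      simp only [r] at hk
      rw [Pi.add_apply]
      linarith
    refine ⟨(hsublevel 1 one_pos).1, fun w hw => le_trans ?_ (hmin w hw)⟩
    exact le_of_forall_pos_le_add fun ε hε => (hsublevel ε hε).2
  obtain ⟨z, ⟨hz, hzmin⟩, hxz⟩ := exists_tendsto_inner_of_variable_metric hsa hν hWlow
    (exists_tendsto_apply_of_le_one_add_mul hsa hμ hW0 hWhigh hη0 hηsum hWmono) hxbdd
    (fun z hz => (hfejer z hz.1 hz.2).1) hcluster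
  have hzm : f z + g z = f m + g m := le_antisymm (hzmin m hm) (hmin z hz)
  have hd_sq : Tendsto (fun k => ‖y k - x k‖ ^ 2) atTop (𝓝 0) := by
    have h := hsδ.tendsto_atTop_zero.const_mul (M / lam₀ / ν)
    rw [mul_zero] at h
    refine squeeze_zero (fun k => sq_nonneg _) (fun k => ?_) h
    rw [div_mul_eq_mul_div, le_div_iff₀ hν, mul_comm]
    exact (hWlow k _).trans ((hlen k).trans (mul_le_mul_of_nonneg_right (hγM k) (hδ k)))
  have hd : Tendsto (fun k => y k - x k) atTop (𝓝 0) := by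
    rw [tendsto_zero_iff_norm_tendsto_zero]
    simpa using hd_sq.sqrt
  refine ⟨z, hz, hzmin, hxz, fun u => ?_, ?_, ?_⟩
  · have h := (hxz u).add (hd.inner (tendsto_const_nhds (x := u)))
    rw [inner_zero_left, add_zero] at h
    refine h.congr fun k => ?_
    rw [← inner_add_left, add_sub_cancel]
  · have hup : Tendsto (fun k => f z + g z + r k + L / 2 * ‖y k - x k‖ ^ 2) atTop
        (𝓝 (f z + g z)) := by
      simpa using (hr_lim.const_add (f z + g z)).add (hd_sq.const_mul (L / 2))
    refine tendsto_of_tendsto_of_tendsto_of_le_of_le tendsto_const_nhds hup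
      (fun k => hzmin _ (hy k).1) fun k => ?_
    have h := le_add_inner_gateaux_add_sq hdomg_cvx hgat hlip (hxmem k) (hy k).1
    have hδk := hδ k
    simp only [δ] at hδk
    simp only [r]
    linarith
  · rw [hzm]
    exact hr_anti.tendsto_natCast_mul_of_summable hsr
end
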